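/- Let (X, 𝒜, μ) be a σ-finite measure space, let n ≥ 1, and let p₁, …, pₙ be probability measures on X with densities f₁, …, fₙ with respect to μ. Let μ̄ := (1/n) Σₖ pₖ. Then the supremum over all measurable critics g : X → Δⁿ⁻¹ (probability-simplex-valued) of the objective Σₖ ∫ fₖ log(gₖ) dμ equals −n·log n + Σₖ KL(pₖ ‖ μ̄), where KL denotes Kullback–Leibler divergence and the conventions 0·log 0 = 0 apply. -/

import Mathlib

open MeasureTheory
open scoped ENNReal BigOperators

/-- The extended negative logarithm `t ↦ -log t` as a map `ℝ → ℝ≥0∞`, with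
`-log 0 = ∞`.  For `t ∈ (0, 1]` (the relevant range for simplex-valued critics) this is
`ENNReal.ofReal (-log t)`. -/
noncomputable def negLog (t : ℝ) : ℝ≥0∞ :=
  if t = 0 then ⊤ else ENNReal.ofReal (-Real.log t)

/-- Kullback–Leibler divergence `KL(μ ‖ ν)`, as an extended real number: it equals
`∫ log (dμ/dν) dμ` when `μ ≪ ν` (and this integral is well defined), and `+∞`
otherwise. -/
noncomputable def klDiv {X : Type*} [MeasurableSpace X] (μ ν : Measure X) : EReal :=
  open scoped Classical in
  if μ ≪ ν ∧ Integrable (llr μ ν) μ then ((∫ x, llr μ ν x ∂μ : ℝ) : EReal) else ⊤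

/-- The critic objective `∑ₖ ∫ fₖ(x) · log(g(x)ₖ) dμ(x)` for densities `f` and a
simplex-valued critic `g`, as an extended real number.  Since `g(x)ₖ ∈ [0,1]`, each
integrand is nonpositive, and the objective is computed as minus a sum of lower
integrals; the conventions `0 · log 0 = 0` (here `0 · ∞ = 0` in `ℝ≥0∞`) and
`fₖ(x) · log 0 = -∞` for `fₖ(x) > 0` hold automatically. -/
noncomputable def criticObjective {X : Type*} [MeasurableSpace X] (μ : Measure X)
    {n : ℕ} (f : Fin n → X → ℝ≥0∞) (g : X → Fin n → ℝ) : EReal :=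
  -(((∑ k, ∫⁻ x, f k x * negLog (g x k) ∂μ) : ℝ≥0∞) : EReal)

lemma measurable_negLog : Measurable negLog :=
  Measurable.ite (measurableSet_singleton 0) measurable_const
    Real.measurable_log.neg.ennreal_ofReal

lemma negLog_of_ne_zero {t : ℝ} (ht : t ≠ 0) : negLog t = ENNReal.ofReal (-Real.log t) :=
  if_neg ht

lemma ofReal_mul_negLog {a t : ℝ} (ha : 0 ≤ a) (h : a ≠ 0 → t ≠ 0) :
    ENNReal.ofReal a * negLog t = ENNReal.ofReal (a * -Real.log t) := by
  rcases eq_or_ne a 0 with rfl | ha0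
  · simp
  · rw [negLog_of_ne_zero (h ha0), ENNReal.ofReal_mul ha]

/-- Gibbs' inequality for probability vectors. -/
lemma sum_ofReal_mul_negLog_self_le {ι : Type*} [Fintype ι] {a b : ι → ℝ}
    (ha : ∀ k, 0 ≤ a k) (hb : ∀ k, 0 ≤ b k) (ha1 : ∑ k, a k = 1) (hb1 : ∑ k, b k = 1) :
    ∑ k, ENNReal.ofReal (a k) * negLog (a k) ≤ ∑ k, ENNReal.ofReal (a k) * negLog (b k) := by
  by_cases h : ∀ k, a k ≠ 0 → b k ≠ 0
  · have ha' : ∀ k, a k ≤ 1 := fun k =>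
      ha1 ▸ Finset.single_le_sum (fun i _ => ha i) (Finset.mem_univ k)
    have hb' : ∀ k, b k ≤ 1 := fun k =>
      hb1 ▸ Finset.single_le_sum (fun i _ => hb i) (Finset.mem_univ k)
    rw [Finset.sum_congr rfl fun k _ => ofReal_mul_negLog (ha k) id,
      Finset.sum_congr rfl fun k _ => ofReal_mul_negLog (ha k) (h k),
      ← ENNReal.ofReal_sum_of_nonneg fun k _ =>
        mul_nonneg (ha k) (neg_nonneg.2 (Real.log_nonpos (ha k) (ha' k))),
      ← ENNReal.ofReal_sum_of_nonneg fun k _ =>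
        mul_nonneg (ha k) (neg_nonneg.2 (Real.log_nonpos (hb k) (hb' k)))]
    refine ENNReal.ofReal_le_ofReal ?_
    have key : ∀ k, a k * -Real.log (a k) ≤ a k * -Real.log (b k) + (b k - a k) := by
      intro k
      rcases (ha k).eq_or_lt with h0 | h0
      · simp [← h0, hb k]
      · have hbk : 0 < b k := lt_of_le_of_ne (hb k) (h k h0.ne').symm
        have h1 := mul_le_mul_of_nonneg_left
          (Real.log_le_sub_one_of_pos (div_pos hbk h0)) h0.le
        rw [Real.log_div hbk.ne' h0.ne', mul_sub, mul_sub, mul_div_cancel₀ _ h0.ne'] at h1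
        linarith
    calc ∑ k, a k * -Real.log (a k)
        ≤ ∑ k, (a k * -Real.log (b k) + (b k - a k)) := Finset.sum_le_sum fun k _ => key k
      _ = ∑ k, a k * -Real.log (b k) := by
        rw [Finset.sum_add_distrib, Finset.sum_sub_distrib, ha1, hb1]; ring
  · push Not at h
    obtain ⟨k, hak, hbk⟩ := h
    have hpos : ENNReal.ofReal (a k) ≠ 0 := by
      simpa using lt_of_le_of_ne (ha k) hak.symm
    have htop : ∑ k, ENNReal.ofReal (a k) * negLog (b k) = ⊤ :=
      ENNReal.sum_eq_top.2 ⟨k, Finset.mem_univ k, by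
        rw [hbk, negLog, if_pos rfl, ENNReal.mul_top hpos]⟩
    exact htop ▸ le_top

lemma ereal_coe_sum {ι : Type*} (s : Finset ι) (a : ι → ℝ) :
    ((∑ k ∈ s, a k : ℝ) : EReal) = ∑ k ∈ s, (a k : EReal) :=
  map_sum (⟨⟨Real.toEReal, EReal.coe_zero⟩, EReal.coe_add⟩ : ℝ →+ EReal) a s

section Mixture

variable {X : Type*} [MeasurableSpace X]

/-- Finitely many finite measures have densities with respect to their sum which form a
probability vector at every point. -/
lemma exists_simplex_density {ι : Type*} [Fintype ι] [Nonempty ι] (p : ι → Measure X)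
    [∀ k, IsFiniteMeasure (p k)] :
    ∃ h : X → ι → ℝ, Measurable h ∧ (∀ x k, 0 ≤ h x k) ∧ (∀ x, ∑ k, h x k = 1) ∧
      ∀ k, p k = (∑ j, p j).withDensity fun x => ENNReal.ofReal (h x k) := by
  classical
  set S : Measure X := ∑ j, p j with hS
  have hac : ∀ k, p k ≪ S := fun k =>
    (Measure.le_iff.2 fun s _ => by
      rw [hS, Measure.finsetSum_apply]
      exact Finset.single_le_sum (f := fun j => p j s) (fun _ _ => zero_le)
        (Finset.mem_univ k)).absolutelyContinuous
  let r : ι → X → ℝ≥0∞ := fun k => (p k).rnDeriv S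
  have hr : ∀ k, Measurable (r k) := fun k => Measure.measurable_rnDeriv _ _
  have hpr : ∀ k, S.withDensity (r k) = p k := fun k => Measure.withDensity_rnDeriv_eq _ _ (hac k)
  have hsum : ∀ᵐ x ∂S, ∑ k, r k x = 1 := by
    have hm : Measurable fun x => ∑ k, r k x := Finset.measurable_sum _ fun k _ => hr k
    refine (withDensity_eq_iff_of_sigmaFinite hm.aemeasurable
      (measurable_const (a := (1 : ℝ≥0∞))).aemeasurable).1 ?_
    ext s hs
    rw [withDensity_apply _ hs, withDensity_apply _ hs, lintegral_finsetSum _ fun k _ => hr k,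
      setLIntegral_one]
    conv_rhs => rw [hS, Measure.finsetSum_apply]
    exact Finset.sum_congr rfl fun k _ => by rw [← withDensity_apply _ hs, hpr]
  let A : Set X := {x | ∑ k, r k x = 1}
  have hA : MeasurableSet A :=
    (Finset.measurable_sum _ fun k _ => hr k) (measurableSet_singleton 1)
  have hfin : ∀ x ∈ A, ∀ k, r k x ≠ ⊤ := fun x hx k =>
    ENNReal.sum_ne_top.1 (by rw [show ∑ k, r k x = 1 from hx]; simp) k (Finset.mem_univ k)
  refine ⟨fun x k => if x ∈ A then (r k x).toReal else (Fintype.card ι : ℝ)⁻¹, ?_, ?_, ?_, ?_⟩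
  · exact measurable_pi_lambda _ fun k => Measurable.ite hA (hr k).ennreal_toReal measurable_const
  · intro x k
    dsimp only
    split_ifs <;> positivity
  · intro x
    by_cases hx : x ∈ A
    · simp only [hx, if_true]
      rw [← ENNReal.toReal_sum fun k _ => hfin x hx k, show ∑ k, r k x = 1 from hx,
        ENNReal.toReal_one]
    · simp [hx]
  · intro k
    rw [← hpr k]
    refine withDensity_congr_ae ?_
    filter_upwards [hsum] with x hx
    have hx' : x ∈ A := hx
    simp only [hx', if_true]
    exact (ENNReal.ofReal_toReal (hfin x hx' k)).symm

variable {P S : Measure X} {h : X → ℝ}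

lemma ae_pos_of_eq_withDensity (hm : Measurable h)
    (hP : P = S.withDensity fun x => ENNReal.ofReal (h x)) : ∀ᵐ x ∂P, 0 < h x := by
  rw [hP, ae_withDensity_iff hm.ennreal_ofReal]
  exact Filter.Eventually.of_forall fun x hx => by simpa using hx

lemma integrable_log_of_eq_withDensity [IsFiniteMeasure S] (hm : Measurable h)
    (h0 : ∀ x, 0 ≤ h x) (h1 : ∀ x, h x ≤ 1)
    (hP : P = S.withDensity fun x => ENNReal.ofReal (h x)) :
    Integrable (fun x => Real.log (h x)) P := by
  rw [hP, integrable_withDensity_iff hm.ennreal_ofReal (by simp)]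
  refine Integrable.of_bound (C := 1)
    (hm.log.mul hm.ennreal_ofReal.ennreal_toReal).aestronglyMeasurable
    (Filter.Eventually.of_forall fun x => ?_)
  rw [ENNReal.toReal_ofReal (h0 x), Real.norm_eq_abs]
  rcases (h0 x).eq_or_lt with hx | hx
  · simp [← hx]
  · exact (Real.abs_log_mul_self_lt _ hx (h1 x)).le

lemma lintegral_negLog_of_eq_withDensity [IsFiniteMeasure S] (hm : Measurable h)
    (h0 : ∀ x, 0 ≤ h x) (h1 : ∀ x, h x ≤ 1)
    (hP : P = S.withDensity fun x => ENNReal.ofReal (h x)) :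
    ∫⁻ x, negLog (h x) ∂P = ENNReal.ofReal (-∫ x, Real.log (h x) ∂P) := by
  have hint : Integrable (fun x => -Real.log (h x)) P :=
    (integrable_log_of_eq_withDensity hm h0 h1 hP).neg
  rw [← integral_neg, ofReal_integral_eq_lintegral_ofReal hint
    (Filter.Eventually.of_forall fun x => neg_nonneg.2 (Real.log_nonpos (h0 x) (h1 x)))]
  refine lintegral_congr_ae ?_
  filter_upwards [ae_pos_of_eq_withDensity hm hP] with x hx
  exact negLog_of_ne_zero hx.ne'

lemma klDiv_inv_smul_of_eq_withDensity [IsProbabilityMeasure P] [IsFiniteMeasure S]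
    (hm : Measurable h) (h0 : ∀ x, 0 ≤ h x) (h1 : ∀ x, h x ≤ 1)
    (hP : P = S.withDensity fun x => ENNReal.ofReal (h x)) {n : ℕ} (hn : n ≠ 0) :
    klDiv P ((n : ℝ≥0∞)⁻¹ • S) = ((Real.log n + ∫ x, Real.log (h x) ∂P : ℝ) : EReal) := by
  have hn0 : (n : ℝ≥0∞) ≠ 0 := by exact_mod_cast hn
  have hnR : (n : ℝ) ≠ 0 := by exact_mod_cast hn
  have : IsFiniteMeasure ((n : ℝ≥0∞)⁻¹ • S) := S.smul_finite (ENNReal.inv_ne_top.2 hn0)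
  have hd : Measurable fun x => (n : ℝ≥0∞) * ENNReal.ofReal (h x) :=
    hm.ennreal_ofReal.const_mul _
  have hPm : P = ((n : ℝ≥0∞)⁻¹ • S).withDensity fun x => (n : ℝ≥0∞) * ENNReal.ofReal (h x) := by
    rw [withDensity_smul_measure]
    change P = _ • S.withDensity ((n : ℝ≥0∞) • fun x => ENNReal.ofReal (h x))
    rw [withDensity_smul _ hm.ennreal_ofReal, ← hP, smul_smul,
      ENNReal.inv_mul_cancel hn0 (ENNReal.natCast_ne_top n), one_smul]
  have hac : P ≪ (n : ℝ≥0∞)⁻¹ • S := by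
    conv_lhs => rw [hPm]
    exact withDensity_absolutelyContinuous _ _
  have hllr : llr P ((n : ℝ≥0∞)⁻¹ • S) =ᵐ[P] fun x => Real.log n + Real.log (h x) := by
    have hrn := Measure.rnDeriv_withDensity ((n : ℝ≥0∞)⁻¹ • S) hd
    rw [← hPm] at hrn
    filter_upwards [hac.ae_le hrn, ae_pos_of_eq_withDensity hm hP] with x hx hpos
    rw [llr, hx, ENNReal.toReal_mul, ENNReal.toReal_natCast, ENNReal.toReal_ofReal (h0 x),
      Real.log_mul hnR hpos.ne']
  have hint := integrable_log_of_eq_withDensity hm h0 h1 hP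
  rw [klDiv, if_pos ⟨hac, ((integrable_const _).add hint).congr hllr.symm⟩,
    integral_congr_ae hllr, integral_add (integrable_const _) hint]
  simp

end Mixture

/-- Value of the inner maximization of the JointGAN objective: for probability measures
`p₁, …, pₙ` with densities `f₁, …, fₙ` with respect to a σ-finite measure `μ`, the
supremum over all measurable simplex-valued critics `g` of
`∑ₖ ∫ fₖ log(gₖ) dμ` equals `-n log n + ∑ₖ KL(pₖ ‖ μ̄)`, where
`μ̄ = (1/n) ∑ⱼ pⱼ` is the uniform mixture. -/
theorem iSup_criticObjective_eq {X : Type*} [MeasurableSpace X] (μ : Measure X)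
    [SigmaFinite μ] (n : ℕ) (hn : 1 ≤ n)
    (f : Fin n → X → ℝ≥0∞) (hf_meas : ∀ k, Measurable (f k))
    (p : Fin n → Measure X) (hp : ∀ k, p k = μ.withDensity (f k))
    (hprob : ∀ k, IsProbabilityMeasure (p k)) :
    (⨆ g : {g : X → Fin n → ℝ // Measurable g ∧ (∀ x k, 0 ≤ g x k) ∧
        ∀ x, ∑ k, g x k = 1}, criticObjective μ f g.1)
      = ((-(n * Real.log n) : ℝ) : EReal)
        + ∑ k, klDiv (p k) ((n : ℝ≥0∞)⁻¹ • ∑ j, p j) := by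
  have : Nonempty (Fin n) := ⟨⟨0, hn⟩⟩
  obtain ⟨h, hm, h0, hs, hd⟩ := exists_simplex_density p
  have hmk : ∀ k, Measurable fun x => h x k := fun k => (measurable_pi_apply k).comp hm
  have h1 : ∀ x k, h x k ≤ 1 := fun x k =>
    hs x ▸ Finset.single_le_sum (fun i _ => h0 x i) (Finset.mem_univ k)
  have hobj : ∀ g : X → Fin n → ℝ, Measurable g →
      criticObjective μ f g = -((∑ k, ∫⁻ x, negLog (g x k) ∂(p k) : ℝ≥0∞) : EReal) := by
    intro g hg
    rw [criticObjective]
    congr 2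
    refine Finset.sum_congr rfl fun k _ => ?_
    have hgk : Measurable fun x => negLog (g x k) :=
      measurable_negLog.comp ((measurable_pi_apply k).comp hg)
    rw [hp k, lintegral_withDensity_eq_lintegral_mul _ (hf_meas k) hgk]
    rfl
  have hmix : ∀ g : X → Fin n → ℝ, Measurable g →
      ∑ k, ∫⁻ x, negLog (g x k) ∂(p k)
        = ∫⁻ x, ∑ k, ENNReal.ofReal (h x k) * negLog (g x k) ∂(∑ j, p j) := by
    intro g hg
    have hgk : ∀ k, Measurable fun x => negLog (g x k) := fun k =>
      measurable_negLog.comp ((measurable_pi_apply k).comp hg)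
    have hprod : ∀ k, Measurable fun x => ENNReal.ofReal (h x k) * negLog (g x k) := fun k =>
      (hmk k).ennreal_ofReal.mul (hgk k)
    rw [lintegral_finsetSum _ fun k _ => hprod k]
    refine Finset.sum_congr rfl fun k _ => ?_
    conv_lhs => rw [hd k]
    rw [lintegral_withDensity_eq_lintegral_mul _ (hmk k).ennreal_ofReal (hgk k)]
    rfl
  have hval : criticObjective μ f h = ((-(n * Real.log n) : ℝ) : EReal)
        + ∑ k, klDiv (p k) ((n : ℝ≥0∞)⁻¹ • ∑ j, p j) := by
    have hnonneg : ∀ k, 0 ≤ -∫ x, Real.log (h x k) ∂(p k) := fun k =>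
      neg_nonneg.2 (integral_nonpos fun x => Real.log_nonpos (h0 x k) (h1 x k))
    rw [hobj h hm, Finset.sum_congr rfl fun k _ => lintegral_negLog_of_eq_withDensity (hmk k)
        (fun x => h0 x k) (fun x => h1 x k) (hd k),
      Finset.sum_congr rfl fun k _ => klDiv_inv_smul_of_eq_withDensity (hmk k)
        (fun x => h0 x k) (fun x => h1 x k) (hd k) (by omega : n ≠ 0),
      ← ENNReal.ofReal_sum_of_nonneg fun k _ => hnonneg k, EReal.coe_ennreal_ofReal,
      max_eq_left (Finset.sum_nonneg fun k _ => hnonneg k), ← EReal.coe_neg,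
      ← ereal_coe_sum, ← EReal.coe_add, Finset.sum_add_distrib]
    congr 1
    simp
  refine le_antisymm (iSup_le fun g => ?_) ?_
  · rw [← hval, hobj h hm, hobj g.1 g.2.1, EReal.neg_le_neg_iff, EReal.coe_ennreal_le_coe_ennreal_iff,
      hmix h hm, hmix g.1 g.2.1]
    exact lintegral_mono fun x =>
      sum_ofReal_mul_negLog_self_le (h0 x) (g.2.2.1 x) (hs x) (g.2.2.2 x)
  · rw [← hval]
    exact le_iSup (fun g : {g : X → Fin n → ℝ // Measurable g ∧ (∀ x k, 0 ≤ g x k) ∧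
        ∀ x, ∑ k, g x k = 1} => criticObjective μ f g.1) ⟨h, hm, h0, hs⟩
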